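/- arXiv:0804.2832 — 3 statements merged into one kernel-verified Lean document; each statement's English description precedes it below -/
import Mathlib

section
/- Let X be a Banach space, N' ⊆ ℕ infinite, and (M_n)_{n∈N'} a sequence of nonzero closed subspaces of X. If λ_{N'}[M_n, {0}] < 1/2 (the adjustment with the constant null-subspace sequence), then there exist a closed subspace Q ⊆ X with dim X/Q < ∞, a number K ∈ N', and a constant c > 0 such that for every m ∈ N' with m > K: M_m ∩ Q = {0}, and ‖v‖ ≤ c·‖u + v‖ for all u ∈ M_m and v ∈ Q (i.e., the natural projections of M_m ⊕ Q onto Q are uniformly bounded in norm). -/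
open Filter Set

/-- Limit superior of a real sequence along the elements of a subset `N` of `ℕ`. -/
noncomputable def limsupAlong (N : Set ℕ) (f : ℕ → ℝ) : ℝ :=
  Filter.limsup f (Filter.atTop ⊓ Filter.principal N)

/-- The sequence of subspaces `M` (indexed by the infinite set `N'`) is lower uniformly
`lam`-adjusted with the sequence of subspaces `P`. -/
def IsLowerUnifAdjusted {X : Type*} [NormedAddCommGroup X] [NormedSpace ℝ X]
    (N' : Set ℕ) (M P : ℕ → Submodule ℝ X) (lam : ℝ) : Prop :=
  ∀ η : ℝ, 0 < η → ∀ N'' : Set ℕ, N'' ⊆ N' → N''.Infinite →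
    ∀ x : ℕ → X, (∀ n ∈ N'', x n ∈ M n ∧ ‖x n‖ = 1) →
      ∃ N''' : Set ℕ, N''' ⊆ N'' ∧ N'''.Infinite ∧
        ∃ y : ℕ → X, (∀ n ∈ N''', y n ∈ P n) ∧
          ∃ z : X, limsupAlong N''' (fun n => ‖x n - y n - z‖) ≤ lam + η

/-- The uniform adjustment number `λ_{N'}[M_n, P_n]`. -/
noncomputable def unifAdj {X : Type*} [NormedAddCommGroup X] [NormedSpace ℝ X]
    (N' : Set ℕ) (M P : ℕ → Submodule ℝ X) : ℝ :=
  sInf {lam : ℝ | 0 ≤ lam ∧ IsLowerUnifAdjusted N' M P lam}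

/-- The gap `δ(M, P)` between two subspaces of a normed space. -/
noncomputable def gap {X : Type*} [NormedAddCommGroup X] [NormedSpace ℝ X]
    (M P : Submodule ℝ X) : ℝ :=
  sSup ((fun x => Metric.infDist x (P : Set X)) '' {x : X | x ∈ M ∧ ‖x‖ = 1})

/-- Hausdorff measure of non-compactness of a set. -/
noncomputable def hausdorffMNC {Y : Type*} [NormedAddCommGroup Y] (S : Set Y) : ℝ :=
  sInf {e : ℝ | 0 < e ∧ ∃ F : Finset Y, S ⊆ ⋃ c ∈ F, Metric.closedBall c e}

/-- The `q`-norm of a bounded operator: the Hausdorff measure of non-compactness of the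
image of the closed unit ball. -/
noncomputable def qNorm {X Y : Type*} [NormedAddCommGroup X] [NormedSpace ℝ X]
    [NormedAddCommGroup Y] [NormedSpace ℝ Y] (C : X →L[ℝ] Y) : ℝ :=
  hausdorffMNC (⇑C '' Metric.closedBall (0 : X) 1)

/-- Given a closed subspace `G` of `X × Y` (the graph of a closed operator `A`) and a bounded
operator `C`, this is the subspace `{(x, y + C x) : (x, y) ∈ G}`, the graph of `A + C`. -/
def graphShift {X Y : Type*} [NormedAddCommGroup X] [NormedSpace ℝ X]
    [NormedAddCommGroup Y] [NormedSpace ℝ Y] (C : X →L[ℝ] Y)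
    (G : Submodule ℝ (X × Y)) : Submodule ℝ (X × Y) :=
  G.map ((LinearMap.fst ℝ X Y).prod
    (LinearMap.snd ℝ X Y + (C : X →ₗ[ℝ] Y).comp (LinearMap.fst ℝ X Y)))

/-- If finitely many functionals of norm at most one detect
every unit vector of every `M m`, then the common kernel is uniformly transversal to the `M m`. -/
theorem exists_transversal_of_functionals {X : Type*} [NormedAddCommGroup X] [NormedSpace ℝ X]
    {S : Set ℕ} {M : ℕ → Submodule ℝ X} (F : Finset (X →L[ℝ] ℝ)) (hF : ∀ f ∈ F, ‖f‖ ≤ 1)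
    {ε : ℝ} (hε : 0 < ε) (h : ∀ m ∈ S, ∀ u ∈ M m, ‖u‖ = 1 → ∃ f ∈ F, ε ≤ |f u|) :
    ∃ Q : Submodule ℝ X, IsClosed (Q : Set X) ∧ FiniteDimensional ℝ (X ⧸ Q) ∧
      ∃ c : ℝ, 0 < c ∧ ∀ m ∈ S,
        M m ⊓ Q = ⊥ ∧ ∀ u ∈ M m, ∀ v ∈ Q, ‖v‖ ≤ c * ‖u + v‖ := by
  let T : X →L[ℝ] (F → ℝ) := ContinuousLinearMap.pi fun f => (f : X →L[ℝ] ℝ)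
  have hker : ∀ v ∈ T.ker, ∀ f ∈ F, f v = 0 := fun v hv f hf =>
    congrFun (LinearMap.mem_ker.1 hv) ⟨f, hf⟩
  have key : ∀ m ∈ S, ∀ u ∈ M m, ∀ v ∈ T.ker, ε * ‖u‖ ≤ ‖u + v‖ := by
    intro m hm u hu v hv
    rcases eq_or_ne u 0 with rfl | hu0
    · simp
    have hpos : 0 < ‖u‖ := norm_pos_iff.2 hu0
    obtain ⟨f, hf, hfu⟩ := h m hm (‖u‖⁻¹ • u) ((M m).smul_mem _ hu)
      (norm_smul_inv_norm (𝕜 := ℝ) hu0)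
    rw [map_smul, smul_eq_mul, abs_mul, abs_inv, abs_norm, inv_mul_eq_div, le_div_iff₀ hpos] at hfu
    calc ε * ‖u‖ ≤ ‖f (u + v)‖ := by rwa [map_add, hker v hv f hf, add_zero, Real.norm_eq_abs]
      _ ≤ 1 * ‖u + v‖ := f.le_of_opNorm_le (hF f hf) _
      _ = ‖u + v‖ := one_mul _
  refine ⟨T.ker, T.isClosed_ker, ?_, 1 + ε⁻¹, by positivity, fun m hm => ⟨?_, ?_⟩⟩
  · exact (LinearMap.quotKerEquivRange (T : X →ₗ[ℝ] (F → ℝ))).symm.finiteDimensional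
  · rw [Submodule.eq_bot_iff]
    rintro u ⟨hu, hv⟩
    have := key m hm u hu (-u) (neg_mem hv)
    rw [add_neg_cancel, norm_zero] at this
    exact norm_le_zero_iff.1 (nonpos_of_mul_nonpos_right this hε)
  · intro u hu v hv
    have h1 : ‖u‖ ≤ ε⁻¹ * ‖u + v‖ := by
      rw [inv_mul_eq_div, le_div_iff₀ hε, mul_comm]
      exact key m hm u hu v hv
    have h2 : ‖v‖ ≤ ‖u + v‖ + ‖u‖ := by simpa using norm_sub_le (u + v) u
    linarith

/-- If no finite family of functionals of norm at most one detects the unit vectors of `M m` for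
large `m`, then there are almost `1`-separated unit vectors in the `M m`. -/
theorem exists_separated_seq {X : Type*} [NormedAddCommGroup X] [NormedSpace ℝ X]
    {N' : Set ℕ} {M : ℕ → Submodule ℝ X} {ε : ℝ}
    (h : ∀ F : Finset (X →L[ℝ] ℝ), (∀ f ∈ F, ‖f‖ ≤ 1) → ∀ K : ℕ,
      ∃ m ∈ N', K < m ∧ ∃ u ∈ M m, ‖u‖ = 1 ∧ ∀ f ∈ F, |f u| < ε) :
    ∃ (m : ℕ → ℕ) (u : ℕ → X), StrictMono m ∧
      (∀ k, m k ∈ N' ∧ u k ∈ M (m k) ∧ ‖u k‖ = 1) ∧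
      ∀ j k, j < k → 1 - ε < ‖u j - u k‖ := by
  classical
  choose φ hφ hφx using fun x : X => exists_dual_vector'' ℝ x
  obtain ⟨p, hp, hr⟩ := exists_seq_of_forall_finset_exists
    (fun a : ℕ × X => a.1 ∈ N' ∧ a.2 ∈ M a.1 ∧ ‖a.2‖ = 1)
    (fun a b => a.1 < b.1 ∧ 1 - ε < ‖a.2 - b.2‖) (by
      intro s hs
      obtain ⟨m, hm, hK, u, hu, hu1, hF⟩ := h (s.image fun a => φ a.2)
        (by simp only [Finset.mem_image]; rintro _ ⟨a, -, rfl⟩; exact hφ _) (s.sup Prod.fst)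
      refine ⟨(m, u), ⟨hm, hu, hu1⟩, fun a ha => ⟨(Finset.le_sup (f := Prod.fst) ha).trans_lt hK, ?_⟩⟩
      have h1 := (abs_lt.1 (hF _ (Finset.mem_image_of_mem _ ha))).2
      have h2 : φ a.2 a.2 = 1 := by rw [hφx]; simp [(hs a ha).2.2]
      have h3 : φ a.2 (a.2 - u) ≤ ‖a.2 - u‖ :=
        (le_abs_self _).trans (by simpa using (φ a.2).le_of_opNorm_le (hφ _) (a.2 - u))
      rw [map_sub, h2] at h3
      show 1 - ε < ‖a.2 - u‖
      linarith)
  exact ⟨fun k => (p k).1, fun k => (p k).2, fun j k hjk => (hr j k hjk).1, hp,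
    fun j k hjk => (hr j k hjk).2⟩

/-- Along an infinite set, a bound on the limit superior of distances to `z` is attained up to
any loss at two distinct indices. -/
theorem exists_ne_norm_sub_lt {X : Type*} [NormedAddCommGroup X]
    {N : Set ℕ} (hN : N.Infinite) {x : ℕ → X} {C : ℝ} (hx : ∀ n ∈ N, ‖x n‖ ≤ C) {z : X} {r : ℝ}
    (h : limsupAlong N (fun n => ‖x n - z‖) < r) :
    ∃ i ∈ N, ∃ j ∈ N, i < j ∧ ‖x i - x j‖ < 2 * r := by
  have hbdd : IsBoundedUnder (· ≤ ·) (atTop ⊓ 𝓟 N) (fun n => ‖x n - z‖) :=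
    ⟨C + ‖z‖, eventually_map.2 <| eventually_inf_principal.2 <| Eventually.of_forall fun n hn =>
      (norm_sub_le _ _).trans (by gcongr; exact hx n hn)⟩
  obtain ⟨a, ha⟩ := eventually_atTop.1 <| eventually_inf_principal.1 <|
    eventually_lt_of_limsup_lt h hbdd
  obtain ⟨i, hi, hai⟩ := hN.exists_gt a
  obtain ⟨j, hj, hij⟩ := hN.exists_gt i
  refine ⟨i, hi, j, hj, hij, ?_⟩
  have h1 := ha i hai.le hi
  have h2 := ha j (hai.trans hij).le hj
  have h3 := norm_sub_le (x i - z) (x j - z)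
  rw [sub_sub_sub_cancel_right] at h3
  linarith

theorem isLowerUnifAdjusted_one {X : Type*} [NormedAddCommGroup X] [NormedSpace ℝ X]
    (N' : Set ℕ) (M P : ℕ → Submodule ℝ X) : IsLowerUnifAdjusted N' M P 1 := by
  intro η hη N'' _ hinf x hx
  refine ⟨N'', Subset.rfl, hinf, 0, fun n _ => zero_mem _, 0, ?_⟩
  have : (atTop ⊓ 𝓟 N'').NeBot := by
    rw [← frequently_mem_iff_neBot]
    exact Nat.frequently_atTop_iff_infinite.2 hinf
  refine limsup_le_of_le (IsBoundedUnder.isCoboundedUnder_le ⟨0, eventually_map.2 <|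
    Eventually.of_forall fun n => norm_nonneg _⟩) ?_
  filter_upwards [mem_inf_of_right (mem_principal_self N'')] with n hn
  simpa [(hx n hn).2] using hη.le

theorem stmt_4 {X : Type*} [NormedAddCommGroup X] [NormedSpace ℝ X] [CompleteSpace X]
    (N' : Set ℕ) (hN' : N'.Infinite)
    (M : ℕ → Submodule ℝ X)
    (hMc : ∀ n ∈ N', IsClosed (M n : Set X)) (hMne : ∀ n ∈ N', M n ≠ ⊥)
    (h : unifAdj N' M (fun _ => (⊥ : Submodule ℝ X)) < 1 / 2) :
    ∃ Q : Submodule ℝ X, IsClosed (Q : Set X) ∧ FiniteDimensional ℝ (X ⧸ Q) ∧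
      ∃ K ∈ N', ∃ c : ℝ, 0 < c ∧ ∀ m ∈ N', K < m →
        M m ⊓ Q = ⊥ ∧ ∀ u ∈ M m, ∀ v ∈ Q, ‖v‖ ≤ c * ‖u + v‖ := by
  obtain ⟨lam, ⟨-, hadj⟩, hlam⟩ :=
    exists_lt_of_csInf_lt (s := {lam | 0 ≤ lam ∧ IsLowerUnifAdjusted N' M (fun _ => ⊥) lam})
      ⟨1, zero_le_one, isLowerUnifAdjusted_one N' M _⟩ h
  set ε : ℝ := 1 / 2 - lam with hε
  by_cases hF : ∃ F : Finset (X →L[ℝ] ℝ), (∀ f ∈ F, ‖f‖ ≤ 1) ∧ ∃ K : ℕ,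
      ∀ m ∈ N', K < m → ∀ u ∈ M m, ‖u‖ = 1 → ∃ f ∈ F, ε ≤ |f u|
  · obtain ⟨F, hF, K₀, hK₀⟩ := hF
    obtain ⟨K, hK, hK₀K⟩ := hN'.exists_gt K₀
    obtain ⟨Q, hQc, hQf, c, hc, hQ⟩ := exists_transversal_of_functionals
      (S := {m ∈ N' | K < m}) F hF (sub_pos.2 hlam) fun m hm => hK₀ m hm.1 (hK₀K.trans hm.2)
    exact ⟨Q, hQc, hQf, K, hK, c, hc, fun m hm hKm => hQ m ⟨hm, hKm⟩⟩
  · push Not at hF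
    obtain ⟨m, u, hm, hu, hsep⟩ := exists_separated_seq hF
    have hx : ∀ k, Function.extend m u 0 (m k) = u k := hm.injective.extend_apply u 0
    have hxM : ∀ n ∈ range m, Function.extend m u 0 n ∈ M n ∧ ‖Function.extend m u 0 n‖ = 1 := by
      rintro _ ⟨k, rfl⟩
      rw [hx]
      exact (hu k).2
    obtain ⟨N, hNm, hN, y, hy, z, hz⟩ := hadj (ε / 4) (by linarith) (range m)
      (range_subset_iff.2 fun k => (hu k).1) (infinite_range_of_injective hm.injective) _ hxM
    obtain ⟨i, hi, j, hj, hij, hlt⟩ := exists_ne_norm_sub_lt (r := lam + ε / 2) hN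
      (x := fun n => Function.extend m u 0 n - y n) (C := 1)
      (fun n hn => by simp [(Submodule.mem_bot ℝ).1 (hy n hn), (hxM n (hNm hn)).2])
      (hz.trans_lt (by linarith))
    obtain ⟨⟨a, rfl⟩, ⟨b, rfl⟩⟩ := And.intro (hNm hi) (hNm hj)
    have := hsep a b (hm.lt_iff_lt.1 hij)
    simp only [hx, (Submodule.mem_bot ℝ).1 (hy _ hi), (Submodule.mem_bot ℝ).1 (hy _ hj),
      sub_zero] at hlt
    linarith
end

section
/- Let ℓ∞ denote the Banach space of bounded real sequences with the supremum norm. There exists a sequence (M_n)_{n∈ℕ} of nonzero closed subspaces of ℓ∞ such that λ_ℕ[M_n, {0}] = 1/2 and dim M_n → ∞ (for every k ∈ ℕ one has dim M_n ≥ k for all sufficiently large n). -/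
open Filter Set

/-- The sequences in `ℓ∞` that vanish off the set `S`. -/
def supportedSeq (S : Set ℕ) : Submodule ℝ (lp (fun _ : ℕ => ℝ) ⊤) where
  carrier := {x | ∀ k, k ∉ S → x k = 0}
  zero_mem' := fun k _ => by simp
  add_mem' := fun {a b} ha hb k hk => by simp [ha k hk, hb k hk]
  smul_mem' := fun c a ha k hk => by simp [ha k hk]

theorem mem_supportedSeq {S : Set ℕ} {x : lp (fun _ : ℕ => ℝ) ⊤} :
    x ∈ supportedSeq S ↔ ∀ k, k ∉ S → x k = 0 :=
  Iff.rfl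

theorem abs_apply_le_norm_lpTop (x : lp (fun _ : ℕ => ℝ) ⊤) (k : ℕ) : |x k| ≤ ‖x‖ :=
  lp.norm_apply_le_norm ENNReal.top_ne_zero x k

theorem isClosed_supportedSeq (S : Set ℕ) :
    IsClosed (supportedSeq S : Set (lp (fun _ : ℕ => ℝ) ⊤)) := by
  have h : (supportedSeq S : Set (lp (fun _ : ℕ => ℝ) ⊤)) =
      ⋂ k ∈ Sᶜ, {x : lp (fun _ : ℕ => ℝ) ⊤ | x k = 0} := by
    ext x
    simp [mem_supportedSeq]
  rw [h]
  refine isClosed_biInter fun k _ => isClosed_eq ?_ continuous_const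
  refine LipschitzWith.continuous (K := 1) (LipschitzWith.of_dist_le_mul fun x y => ?_)
  simpa [dist_eq_norm] using abs_apply_le_norm_lpTop (x - y) k

theorem single_mem_supportedSeq {S : Set ℕ} {j : ℕ} (hj : j ∈ S) (a : ℝ) :
    lp.single ⊤ j a ∈ supportedSeq S := by
  intro k hk
  have hkj : k ≠ j := fun h => hk (h ▸ hj)
  simp [hkj]

theorem card_le_rank_supportedSeq {S : Set ℕ} {k : ℕ} (f : Fin k → ℕ)
    (hf : Function.Injective f) (hS : ∀ i, f i ∈ S) :
    (k : Cardinal) ≤ Module.rank ℝ (supportedSeq S) := by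
  let v : Fin k → supportedSeq S := fun i => ⟨lp.single ⊤ (f i) 1, single_mem_supportedSeq (hS i) 1⟩
  have hv : LinearIndependent ℝ v := by
    rw [Fintype.linearIndependent_iff]
    intro g hg i
    let ev : supportedSeq S →ₗ[ℝ] ℝ :=
      { toFun := fun w => (w : lp (fun _ : ℕ => ℝ) ⊤) (f i)
        map_add' := fun _ _ => rfl
        map_smul' := fun _ _ => rfl }
    have hev : ∀ j, ev (v j) = if i = j then 1 else 0 := fun j => by
      change (Pi.single (f j) 1 : ℕ → ℝ) (f i) = _
      simp [Pi.single_apply, hf.eq_iff]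
    have h := congrArg ev hg
    simpa [hev] using h
  simpa using hv.cardinal_le_rank

theorem isBoundedUnder_norm_sub {X : Type*} [NormedAddCommGroup X] {N : Set ℕ} {x : ℕ → X}
    {C : ℝ} (hx : ∀ n ∈ N, ‖x n‖ ≤ C) (z : X) :
    IsBoundedUnder (· ≤ ·) (atTop ⊓ 𝓟 N) (fun n => ‖x n - z‖) := by
  refine ⟨C + ‖z‖, ?_⟩
  rw [eventually_map, eventually_inf_principal]
  exact Eventually.of_forall fun n hn => (norm_sub_le _ _).trans (by gcongr; exact hx n hn)

theorem neBot_atTop_inf_principal {N : Set ℕ} (hN : N.Infinite) : NeBot (atTop ⊓ 𝓟 N) := by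
  rw [← frequently_mem_iff_neBot]
  exact Nat.frequently_atTop_iff_infinite.2 hN

theorem limsupAlong_le {N : Set ℕ} (hN : N.Infinite) {f : ℕ → ℝ} {c : ℝ} (h0 : ∀ n, 0 ≤ f n)
    (h : ∀ n ∈ N, f n ≤ c) : limsupAlong N f ≤ c := by
  have := neBot_atTop_inf_principal hN
  refine limsup_le_of_le (IsBoundedUnder.isCoboundedUnder_le ⟨0, ?_⟩) ?_
  · exact eventually_map.2 (Eventually.of_forall h0)
  · exact eventually_inf_principal.2 (Eventually.of_forall h)

/-- A `1`-separated sequence has asymptotic distance at least `1 / 2` from every vector. -/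
theorem half_le_limsupAlong_norm_sub {X : Type*} [NormedAddCommGroup X] {N : Set ℕ}
    (hN : N.Infinite) {x : ℕ → X} {C : ℝ} (hx : ∀ n ∈ N, ‖x n‖ ≤ C)
    (hsep : ∀ n ∈ N, ∀ m ∈ N, n ≠ m → 1 ≤ ‖x n - x m‖) (z : X) :
    1 / 2 ≤ limsupAlong N (fun n => ‖x n - z‖) := by
  by_contra! hlt
  have hev := eventually_inf_principal.1
    (eventually_lt_of_limsup_lt hlt (isBoundedUnder_norm_sub hx z))
  obtain ⟨K, hK⟩ := eventually_atTop.1 hev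
  obtain ⟨n, hn, hKn⟩ := hN.exists_gt K
  obtain ⟨m, hm, hnm⟩ := hN.exists_gt n
  have h1 := hK n hKn.le hn
  have h2 := hK m (hKn.trans hnm).le hm
  have h3 := hsep n hn m hm hnm.ne
  have h4 : ‖x n - x m‖ ≤ ‖x n - z‖ + ‖x m - z‖ := by
    simpa using norm_sub_le (x n - z) (x m - z)
  linarith

theorem isLowerUnifAdjusted_half_of_pairwise_disjoint {S : ℕ → Set ℕ}
    (hS : Pairwise (Function.onFun Disjoint S)) :
    IsLowerUnifAdjusted Set.univ (fun n => supportedSeq (S n)) (fun _ => ⊥) (1 / 2) := by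
  classical
  intro η hη N _ hN x hx
  refine ⟨N, Subset.rfl, hN, 0, by simp, ?_⟩
  have hx1 : ∀ n ∈ N, ∀ k, |x n k| ≤ 1 := fun n hn k =>
    (hx n hn).2 ▸ abs_apply_le_norm_lpTop (x n) k
  let w : ℕ → ℝ := fun k => if h : ∃ n ∈ N, k ∈ S n then x h.choose k / 2 else 0
  have hw : ∀ k, |w k| ≤ 1 / 2 := by
    intro k
    by_cases h : ∃ n ∈ N, k ∈ S n
    · have := hx1 _ h.choose_spec.1 k
      simp only [w, dif_pos h, abs_div, abs_two]
      linarith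
    · simp [w, dif_neg h]
  have hweq : ∀ n ∈ N, ∀ k ∈ S n, w k = x n k / 2 := by
    intro n hn k hk
    have h : ∃ n ∈ N, k ∈ S n := ⟨n, hn, hk⟩
    have hc : h.choose = n := by
      by_contra hne
      exact Set.disjoint_left.1 (hS hne) h.choose_spec.2 hk
    simp only [w, dif_pos h, hc]
  have hwmem : Memℓp w ⊤ := memℓp_infty ⟨1 / 2, by rintro _ ⟨k, rfl⟩; exact hw k⟩
  refine ⟨⟨w, hwmem⟩, (limsupAlong_le hN (fun _ => norm_nonneg _) fun n hn => ?_).trans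
    (le_add_of_nonneg_right hη.le)⟩
  refine lp.norm_le_of_forall_le (by norm_num) fun k => ?_
  change |x n k - 0 - w k| ≤ 1 / 2
  by_cases hk : k ∈ S n
  · rw [hweq n hn k hk, show x n k - 0 - x n k / 2 = x n k / 2 by ring, abs_div, abs_two]
    linarith [hx1 n hn k]
  · rw [(hx n hn).1 k hk]
    simpa using hw k

theorem half_le_of_isLowerUnifAdjusted {S : ℕ → Set ℕ}
    (hS : Pairwise (Function.onFun Disjoint S)) (hne : ∀ n, (S n).Nonempty) {lam : ℝ}
    (h : IsLowerUnifAdjusted Set.univ (fun n => supportedSeq (S n)) (fun _ => ⊥) lam) :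
    1 / 2 ≤ lam := by
  choose e he using hne
  let x : ℕ → lp (fun _ : ℕ => ℝ) ⊤ := fun n => lp.single ⊤ (e n) 1
  have hx1 : ∀ n, ‖x n‖ = 1 := fun n => by simp [x, lp.norm_single]
  refine le_of_forall_pos_le_add fun η hη => ?_
  obtain ⟨N, -, hN, y, hy, z, hz⟩ := h η hη Set.univ Subset.rfl Set.infinite_univ x
    fun n _ => ⟨single_mem_supportedSeq (he n) 1, hx1 n⟩
  have hy0 : ∀ n ∈ N, y n = 0 := fun n hn => by simpa using hy n hn
  refine (half_le_limsupAlong_norm_sub (x := fun n => x n - y n) (C := 1) hN ?_ ?_ z).trans hz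
  · intro n hn
    simp [hy0 n hn, hx1]
  · intro n hn m hm hnm
    have hem : e n ≠ e m := fun hem => Set.disjoint_left.1 (hS hnm) (he n) (hem ▸ he m)
    have := abs_apply_le_norm_lpTop (x n - x m) (e n)
    simpa [x, hy0 n hn, hy0 m hm, hem] using this

theorem unifAdj_supportedSeq_bot {S : ℕ → Set ℕ}
    (hS : Pairwise (Function.onFun Disjoint S)) (hne : ∀ n, (S n).Nonempty) :
    unifAdj Set.univ (fun n => supportedSeq (S n)) (fun _ => ⊥) = 1 / 2 :=
  IsLeast.csInf_eq ⟨⟨by norm_num, isLowerUnifAdjusted_half_of_pairwise_disjoint hS⟩,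
    fun _ h => half_le_of_isLowerUnifAdjusted hS hne h.2⟩

/-- in `ℓ∞` (bounded real sequences with sup norm) there is a sequence of
nonzero closed subspaces whose uniform adjustment with the null subspace is `1/2` while
their dimensions tend to infinity. -/
theorem stmt_10 :
    ∃ M : ℕ → Submodule ℝ (lp (fun _ : ℕ => ℝ) ⊤),
      (∀ n, IsClosed (M n : Set (lp (fun _ : ℕ => ℝ) ⊤)) ∧ M n ≠ ⊥) ∧
      unifAdj Set.univ M (fun _ => (⊥ : Submodule ℝ (lp (fun _ : ℕ => ℝ) ⊤))) = 1 / 2 ∧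
      ∀ k : ℕ, ∃ K : ℕ, ∀ n ≥ K, (k : Cardinal) ≤ Module.rank ℝ (M n) := by
  let S : ℕ → Set ℕ := fun n => Nat.pair n '' Set.Iic n
  have hS : Pairwise (Function.onFun Disjoint S) := by
    refine fun n m hnm => Set.disjoint_left.2 ?_
    rintro _ ⟨i, -, rfl⟩ ⟨j, -, hj⟩
    exact hnm (Nat.pair_eq_pair.1 hj).1.symm
  have h0 : ∀ n, Nat.pair n 0 ∈ S n := fun n => ⟨0, Nat.zero_le n, rfl⟩
  refine ⟨fun n => supportedSeq (S n), fun n => ⟨isClosed_supportedSeq _, ?_⟩,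
    unifAdj_supportedSeq_bot hS fun n => ⟨_, h0 n⟩, fun k => ⟨k, fun n hn => ?_⟩⟩
  · intro hbot
    have h := single_mem_supportedSeq (h0 n) 1
    rw [show supportedSeq (S n) = ⊥ from hbot, Submodule.mem_bot] at h
    simpa using congrArg (fun w : lp (fun _ : ℕ => ℝ) ⊤ => w (Nat.pair n 0)) h
  · refine card_le_rank_supportedSeq (fun i : Fin k => Nat.pair n i) ?_ ?_
    · exact fun i j hij => Fin.ext (Nat.pair_eq_pair.1 hij).2
    · exact fun i => ⟨i, i.2.le.trans hn, rfl⟩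
end

section
/- Let (T, τ) be a compact Hausdorff Fréchet–Urysohn topological space, let (G_n)_{n∈ℕ} be a sequence of nonempty subsets of T, and let t ∈ T belong to the closure of G_n for every n ∈ ℕ. Then there exist an infinite set N' ⊆ ℕ and points t_n ∈ G_n (n ∈ N') such that the net (t_n)_{n∈N'} (indexed by N' with its natural order) converges to t. -/
open Filter Set

/-- The point `t` is the limit, along an infinite set of indices, of a selection of `G`. -/
def IsSubselectionLimit {T : Type*} [TopologicalSpace T] (G : ℕ → Set T) (t : T) : Prop :=
  ∃ N : Set ℕ, N.Infinite ∧ ∃ u : ℕ → T, (∀ n ∈ N, u n ∈ G n) ∧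
    Tendsto u (atTop ⊓ Filter.principal N) (nhds t)

theorem IsSubselectionLimit.of_infinite_mem {T : Type*} [TopologicalSpace T] {G : ℕ → Set T}
    {t : T} (h : {n | t ∈ G n}.Infinite) : IsSubselectionLimit G t :=
  ⟨_, h, fun _ => t, fun _ hn => hn, tendsto_const_nhds⟩

theorem IsSubselectionLimit.of_tendsto {T : Type*} [TopologicalSpace T] {G : ℕ → Set T} {t : T}
    {v : ℕ → T} {n : ℕ → ℕ} (hv : Tendsto v atTop (nhds t)) (hmem : ∀ i, v i ∈ G (n i))
    (hn : (range n).Infinite) : IsSubselectionLimit G t := by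
  have hinv : ∀ m ∈ range n, n (Function.invFun n m) = m := fun m hm => Function.invFun_eq hm
  refine ⟨range n, hn, v ∘ Function.invFun n, fun m hm => ?_, hv.comp ?_⟩
  · have := hmem (Function.invFun n m)
    rwa [hinv m hm] at this
  · rw [← Nat.cofinite_eq_atTop]
    intro s hs
    rw [mem_map, mem_inf_principal, mem_cofinite]
    rw [mem_cofinite] at hs
    refine (hs.image n).subset fun m hm => ?_
    simp only [mem_compl_iff, mem_ofPred_eq, mem_preimage, Classical.not_imp] at hm
    exact ⟨_, hm.2, hinv m hm.1⟩

/-- If `t` is in the closure of a family of points `f i ≠ t` with `f i ∈ G (n i)`, where `n` is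
finite-to-one, then `t` is the limit of a subselection of `G`. -/
theorem IsSubselectionLimit.of_mem_closure_image {T ι : Type*} [TopologicalSpace T] [T1Space T]
    [FrechetUrysohnSpace T] {G : ℕ → Set T} {t : T} {f : ι → T} {n : ι → ℕ} {s : Set ι}
    (ht : t ∈ closure (f '' s)) (hmem : ∀ i ∈ s, f i ∈ G (n i)) (hne : ∀ i ∈ s, f i ≠ t)
    (hfin : ∀ m, {i ∈ s | n i = m}.Finite) : IsSubselectionLimit G t := by
  obtain ⟨v, hvs, hv⟩ := mem_closure_iff_seq_limit.1 ht
  choose k hks hkv using hvs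
  refine of_tendsto (n := n ∘ k) hv (fun i => hkv i ▸ hmem _ (hks i)) fun hrange => ?_
  have hk : (range k).Finite := by
    refine (hrange.biUnion fun m _ => hfin m).subset ?_
    rintro _ ⟨i, rfl⟩
    exact mem_biUnion (mem_range_self i) ⟨hks i, rfl⟩
  obtain ⟨_, ⟨i, rfl⟩, hi⟩ := (hk.image f).isClosed.mem_of_tendsto hv
    (Eventually.of_forall fun i => ⟨k i, mem_range_self i, hkv i⟩)
  exact hne _ (hks i) hi

theorem IsSubselectionLimit.of_mapClusterPt {T : Type*} [TopologicalSpace T] [T1Space T]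
    [FrechetUrysohnSpace T] {G : ℕ → Set T} {u : ℕ → T} (hu : ∀ n, u n ∈ G n) {y : T}
    (hy : MapClusterPt y atTop u) : IsSubselectionLimit G y := by
  by_cases h : {n | y ∈ G n}.Infinite
  · exact of_infinite_mem h
  obtain ⟨N, hN⟩ := (not_infinite.1 h).bddAbove
  refine of_mem_closure_image (f := u) (n := id) (s := Ioi N) ?_ (fun i _ => hu i) ?_ ?_
  · rw [mem_closure_iff_clusterPt]
    exact hy.clusterPt.mono (le_principal_iff.2 (image_mem_map (Ioi_mem_atTop N)))
  · rintro i hi rfl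
    exact (mem_Ioi.1 hi).not_ge (hN (hu i))
  · exact fun m => (finite_singleton m).subset fun i hi => hi.2

theorem mem_closure_isSubselectionLimit {T : Type*} [TopologicalSpace T] [CompactSpace T]
    [T2Space T] [FrechetUrysohnSpace T] {G : ℕ → Set T} {t : T} (ht : ∀ n, t ∈ closure (G n)) :
    t ∈ closure {y | IsSubselectionLimit G y} := by
  rw [mem_closure_iff_nhds]
  intro U hU
  obtain ⟨V, hV, hVc, hVU⟩ := exists_mem_nhds_isClosed_subset hU
  choose u huV huG using fun n => mem_closure_iff_nhds.1 (ht n) V hV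
  obtain ⟨y, hy⟩ := exists_clusterPt_of_compactSpace (map u atTop)
  refine ⟨y, hVU ?_, IsSubselectionLimit.of_mapClusterPt huG hy⟩
  rw [← hVc.closure_eq, mem_closure_iff_clusterPt]
  exact hy.mono (le_principal_iff.2 (mem_map.2 (Eventually.of_forall huV)))

/-- Subselection limits are closed under taking closures in a Fréchet–Urysohn `T1` space. -/
theorem isSubselectionLimit_of_mem_closure {T : Type*} [TopologicalSpace T] [T1Space T]
    [FrechetUrysohnSpace T] {G : ℕ → Set T} {t : T}
    (ht : t ∈ closure {y | IsSubselectionLimit G y}) : IsSubselectionLimit G t := by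
  by_cases h : {n | t ∈ G n}.Infinite
  · exact .of_infinite_mem h
  obtain ⟨N, hN⟩ := (not_infinite.1 h).bddAbove
  obtain ⟨y, hy, hyt⟩ := mem_closure_iff_seq_limit.1 ht
  choose A hA f hf hfy using hy
  refine .of_mem_closure_image (f := fun p : ℕ × ℕ => f p.1 p.2) (n := Prod.snd)
    (s := {p | p.2 ∈ A p.1 ∧ p.1 < p.2 ∧ N < p.2}) ?_ (fun p hp => hf _ _ hp.1) ?_ ?_
  · refine isClosed_closure.mem_of_tendsto hyt (Eventually.of_forall fun j => ?_)
    have : (atTop ⊓ Filter.principal (A j)).NeBot :=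
      frequently_mem_iff_neBot.1 (Nat.frequently_atTop_iff_infinite.2 (hA j))
    refine mem_closure_of_tendsto (hfy j) ?_
    filter_upwards [mem_inf_of_right (mem_principal_self (A j)),
      mem_inf_of_left (Ioi_mem_atTop j), mem_inf_of_left (Ioi_mem_atTop N)] with n h₁ h₂ h₃
    exact ⟨(j, n), ⟨h₁, h₂, h₃⟩, rfl⟩
  · rintro p ⟨hp, -, hNp⟩ rfl
    exact hNp.not_ge (hN (hf _ _ hp))
  · refine fun m => ((finite_Iio m).prod (finite_singleton m)).subset ?_
    rintro ⟨j, n⟩ ⟨⟨-, hjn, -⟩, rfl⟩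
    exact ⟨hjn, rfl⟩

theorem stmt_15 {T : Type*} [TopologicalSpace T] [CompactSpace T] [T2Space T]
    [FrechetUrysohnSpace T]
    (G : ℕ → Set T) (hG : ∀ n, (G n).Nonempty)
    (t : T) (ht : ∀ n, t ∈ closure (G n)) :
    ∃ N' : Set ℕ, N'.Infinite ∧ ∃ ts : ℕ → T, (∀ n ∈ N', ts n ∈ G n) ∧
      Filter.Tendsto ts (Filter.atTop ⊓ Filter.principal N') (nhds t) := by
  exact isSubselectionLimit_of_mem_closure (mem_closure_isSubselectionLimit ht)
end
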